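/- Let β ∈ (1,2) be real and let λ, μ ∈ ℂ be two distinct zeros of E_{β,β} (i.e., E_{β,β}(λ) = E_{β,β}(μ) = 0 and λ ≠ μ). Then ∫₀¹ x^{β−1} E_{β,β}(λ x^β) · (1−x)^{β−1} E_{β,β}(μ (1−x)^β) dx = 0. -/

import Mathlib

open Real MeasureTheory

/-- Mittag–Leffler function `E_{a,b}(z) = ∑ₖ zᵏ / Γ(a k + b)`. -/
noncomputable def mittagLeffler (a b : ℝ) (z : ℂ) : ℂ :=
  ∑' k : ℕ, z ^ k / Complex.Gamma ((a * k + b : ℝ) : ℂ)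

theorem summable_norm_pow_div_Gamma {β : ℝ} (hβ : 1 ≤ β) (z : ℂ) :
    Summable fun k : ℕ => ‖z ^ k / Complex.Gamma ((β * k + β : ℝ) : ℂ)‖ := by
  refine Summable.of_norm_bounded_eventually_nat (Real.summable_pow_div_factorial ‖z‖) ?_
  filter_upwards [Filter.eventually_ge_atTop 1] with k hk
  have hk' : (1 : ℝ) ≤ k := by exact_mod_cast hk
  have hle : (k : ℝ) + 1 ≤ β * k + β := by nlinarith
  have hfac : (k.factorial : ℝ) ≤ Real.Gamma (β * k + β) := by
    rw [← Real.Gamma_nat_eq_factorial]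
    exact Real.Gamma_strictMonoOn_Ici.monotoneOn (Set.mem_Ici.2 (by linarith))
      (Set.mem_Ici.2 (by linarith)) hle
  have hpos : (0 : ℝ) < k.factorial := by exact_mod_cast k.factorial_pos
  rw [norm_norm, norm_div, norm_pow, Complex.Gamma_ofReal, Complex.norm_real, Real.norm_eq_abs,
    abs_of_pos (hpos.trans_le hfac)]
  gcongr

theorem hasSum_mittagLeffler {β : ℝ} (hβ : 1 ≤ β) (z : ℂ) :
    HasSum (fun k : ℕ => z ^ k / Complex.Gamma ((β * k + β : ℝ) : ℂ)) (mittagLeffler β β z) :=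
  (summable_norm_pow_div_Gamma hβ z).of_norm.hasSum

theorem integral_rpow_mul_one_sub_rpow {u v : ℝ} (hu : 0 < u) (hv : 0 < v) :
    ∫ x in (0:ℝ)..1, ((x ^ (u - 1) * (1 - x) ^ (v - 1) : ℝ) : ℂ) =
      Complex.Gamma u * Complex.Gamma v / Complex.Gamma ((u + v : ℝ) : ℂ) := by
  have hne : Complex.Gamma ((u + v : ℝ) : ℂ) ≠ 0 :=
    Complex.Gamma_ne_zero_of_re_pos (by simpa using add_pos hu hv)
  rw [Complex.Gamma_mul_Gamma_eq_betaIntegral (by simpa) (by simpa), ← Complex.ofReal_add,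
    mul_div_cancel_left₀ _ hne, Complex.betaIntegral]
  refine intervalIntegral.integral_congr fun x hx => ?_
  rw [Set.uIcc_of_le zero_le_one] at hx
  have h1 : 0 ≤ 1 - x := sub_nonneg.2 hx.2
  simp only [Complex.ofReal_mul, Complex.ofReal_cpow hx.1, Complex.ofReal_cpow h1,
    Complex.ofReal_sub, Complex.ofReal_one]

/-- Closed form of the integral of a product of terms of the two Mittag–Leffler series. -/
theorem integral_mittagLeffler_terms {β : ℝ} (hβ : 0 < β) (l m : ℂ) (j k : ℕ) :
    ∫ x in (0:ℝ)..1,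
        ((x ^ (β * j + β - 1) * (1 - x) ^ (β * k + β - 1) : ℝ) : ℂ) *
          (l ^ j / Complex.Gamma ((β * j + β : ℝ) : ℂ) *
            (m ^ k / Complex.Gamma ((β * k + β : ℝ) : ℂ))) =
      l ^ j * m ^ k / Complex.Gamma ((β * ((j + k : ℕ) + 1 : ℕ) + β : ℝ) : ℂ) := by
  have hpos (i : ℕ) : 0 < β * i + β := by positivity
  have hne (i : ℕ) : Complex.Gamma ((β * i + β : ℝ) : ℂ) ≠ 0 :=
    Complex.Gamma_ne_zero_of_re_pos (by simpa using hpos i)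
  rw [intervalIntegral.integral_mul_const, integral_rpow_mul_one_sub_rpow (hpos j) (hpos k)]
  have hsum : β * j + β + (β * k + β) = β * ((j + k : ℕ) + 1 : ℕ) + β := by
    push_cast; ring
  rw [hsum]
  have h1 := hne j
  have h2 := hne k
  have h3 := hne (j + k + 1)
  generalize Complex.Gamma ((β * j + β : ℝ) : ℂ) = a at *
  generalize Complex.Gamma ((β * k + β : ℝ) : ℂ) = b at *
  generalize Complex.Gamma ((β * ((j + k : ℕ) + 1 : ℕ) + β : ℝ) : ℂ) = c at *
  field_simp

theorem rpow_mul_rpow_pow {β x : ℝ} (hβ : 1 < β) (hx : 0 ≤ x) (j : ℕ) :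
    x ^ (β - 1) * (x ^ β) ^ j = x ^ (β * j + β - 1) := by
  rw [← Real.rpow_mul_natCast hx, ← Real.rpow_add_of_nonneg hx (by linarith) (by positivity)]
  ring_nf

/-- The convolution of two Mittag–Leffler kernels, integrated term by term. -/
theorem hasSum_integral_mittagLeffler_mul {β : ℝ} (hβ : 1 < β) (l m : ℂ) :
    HasSum (fun p : ℕ × ℕ => l ^ p.1 * m ^ p.2 /
        Complex.Gamma ((β * ((p.1 + p.2 : ℕ) + 1 : ℕ) + β : ℝ) : ℂ))
      (∫ x in (0:ℝ)..1,
        ((x ^ (β - 1) : ℝ) : ℂ) * mittagLeffler β β (l * ((x ^ β : ℝ) : ℂ)) *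
          (((1 - x) ^ (β - 1) : ℝ) : ℂ) *
            mittagLeffler β β (m * (((1 - x) ^ β : ℝ) : ℂ))) := by
  have hβ0 : 0 < β := by linarith
  have hexp (i : ℕ) : 0 ≤ β * i + β - 1 := by
    have : 0 ≤ β * i := by positivity
    linarith
  simp_rw [← integral_mittagLeffler_terms hβ0]
  refine intervalIntegral.hasSum_integral_of_dominated_convergence
    (fun p _ => ‖l ^ p.1 / Complex.Gamma ((β * p.1 + β : ℝ) : ℂ)‖ *
      ‖m ^ p.2 / Complex.Gamma ((β * p.2 + β : ℝ) : ℂ)‖) (fun p => ?_) (fun p => ?_) ?_ ?_ ?_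
  · refine Measurable.aestronglyMeasurable ?_
    fun_prop
  · refine Filter.Eventually.of_forall fun x hx => ?_
    rw [Set.uIoc_of_le zero_le_one] at hx
    have h1 : 0 ≤ 1 - x := sub_nonneg.2 hx.2
    rw [norm_mul, norm_mul (l ^ p.1 / _), Complex.norm_real, Real.norm_eq_abs,
      abs_of_nonneg (mul_nonneg (Real.rpow_nonneg hx.1.le _) (Real.rpow_nonneg h1 _))]
    refine mul_le_of_le_one_left (by positivity) (mul_le_one₀ ?_ (Real.rpow_nonneg h1 _) ?_)
    · exact Real.rpow_le_one hx.1.le hx.2 (hexp _)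
    · exact Real.rpow_le_one h1 (by linarith [hx.1]) (hexp _)
  · have hsummable := (summable_norm_pow_div_Gamma hβ.le l).mul_of_nonneg
      (summable_norm_pow_div_Gamma hβ.le m) (fun _ => norm_nonneg _) (fun _ => norm_nonneg _)
    exact Filter.Eventually.of_forall fun x _ => hsummable
  · exact intervalIntegrable_const
  · refine Filter.Eventually.of_forall fun x hx => ?_
    rw [Set.uIoc_of_le zero_le_one] at hx
    have h1 : 0 ≤ 1 - x := sub_nonneg.2 hx.2
    have hsummable := summable_mul_of_summable_norm
      (summable_norm_pow_div_Gamma hβ.le (l * ((x ^ β : ℝ) : ℂ)))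
      (summable_norm_pow_div_Gamma hβ.le (m * (((1 - x) ^ β : ℝ) : ℂ)))
    have hmul := ((hasSum_mittagLeffler hβ.le (l * ((x ^ β : ℝ) : ℂ))).mul
      (hasSum_mittagLeffler hβ.le (m * (((1 - x) ^ β : ℝ) : ℂ))) hsummable).mul_left
      (((x ^ (β - 1) : ℝ) : ℂ) * (((1 - x) ^ (β - 1) : ℝ) : ℂ))
    have hterm (p : ℕ × ℕ) :
        ((x ^ (β * p.1 + β - 1) * (1 - x) ^ (β * p.2 + β - 1) : ℝ) : ℂ) *
          (l ^ p.1 / Complex.Gamma ((β * p.1 + β : ℝ) : ℂ) *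
            (m ^ p.2 / Complex.Gamma ((β * p.2 + β : ℝ) : ℂ))) =
        ((x ^ (β - 1) : ℝ) : ℂ) * (((1 - x) ^ (β - 1) : ℝ) : ℂ) *
          ((l * ((x ^ β : ℝ) : ℂ)) ^ p.1 / Complex.Gamma ((β * p.1 + β : ℝ) : ℂ) *
            ((m * (((1 - x) ^ β : ℝ) : ℂ)) ^ p.2 /
              Complex.Gamma ((β * p.2 + β : ℝ) : ℂ))) := by
      rw [← rpow_mul_rpow_pow hβ hx.1.le, ← rpow_mul_rpow_pow hβ h1]
      simp only [Complex.ofReal_mul, Complex.ofReal_pow, mul_pow]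
      ring
    simp_rw [hterm]
    rw [mul_right_comm (((x ^ (β - 1) : ℝ) : ℂ)), mul_assoc (_ * _)]
    exact hmul

/-- Bi-orthogonality: for `1 < β < 2` and distinct zeros `λ ≠ μ` of `E_{β,β}`,
`∫₀¹ x^{β−1} E_{β,β}(λ x^β) (1−x)^{β−1} E_{β,β}(μ (1−x)^β) dx = 0`. -/
theorem biorthogonality_of_eigenfunctions
    (β : ℝ) (hβ : β ∈ Set.Ioo (1 : ℝ) 2) (l m : ℂ)
    (hl : mittagLeffler β β l = 0) (hm : mittagLeffler β β m = 0) (hlm : l ≠ m) :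
    ∫ x in (0:ℝ)..1,
        ((x ^ (β - 1) : ℝ) : ℂ) * mittagLeffler β β (l * ((x ^ β : ℝ) : ℂ)) *
          (((1 - x) ^ (β - 1) : ℝ) : ℂ) *
            mittagLeffler β β (m * (((1 - x) ^ β : ℝ) : ℂ)) = 0 := by
  have hI := hasSum_integral_mittagLeffler_mul hβ.1 l m
  set I := ∫ x in (0:ℝ)..1,
        ((x ^ (β - 1) : ℝ) : ℂ) * mittagLeffler β β (l * ((x ^ β : ℝ) : ℂ)) *
          (((1 - x) ^ (β - 1) : ℝ) : ℂ) *
            mittagLeffler β β (m * (((1 - x) ^ β : ℝ) : ℂ))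
  have hanti := (((Equiv.hasSum_iff (Finset.HasAntidiagonal.sigmaAntidiagonalEquivProd (A := ℕ))).2 hI).sigma
    fun n => hasSum_fintype _).mul_right (l - m)
  have htel : HasSum (fun n : ℕ =>
      l ^ (n + 1) / Complex.Gamma ((β * (n + 1 : ℕ) + β : ℝ) : ℂ) -
        m ^ (n + 1) / Complex.Gamma ((β * (n + 1 : ℕ) + β : ℝ) : ℂ)) (I * (l - m)) := by
    refine hanti.congr_fun fun n => ?_
    rw [← sub_div, ← geom_sum₂_mul, div_eq_mul_inv, mul_right_comm]
    congr 1
    rw [Finset.univ_eq_attach, Finset.sum_mul]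
    have hsum := Finset.Nat.sum_antidiagonal_eq_sum_range_succ
      (fun i j => l ^ i * m ^ j * (Complex.Gamma ((β * (n + 1 : ℕ) + β : ℝ) : ℂ))⁻¹) n
    simp only [Nat.add_sub_cancel]
    rw [← hsum, ← Finset.sum_attach]
    refine Finset.sum_congr rfl fun p _ => ?_
    have hp := Finset.HasAntidiagonal.mem_antidiagonal.1 p.2
    simp [Finset.HasAntidiagonal.sigmaAntidiagonalEquivProd, div_eq_mul_inv, ← hp]
  have hdiff := (hasSum_mittagLeffler hβ.1.le l).sub (hasSum_mittagLeffler hβ.1.le m)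
  rw [hl, hm, sub_zero, ← hasSum_nat_add_iff' 1] at hdiff
  have h0 : I * (l - m) = 0 := by simpa using htel.unique hdiff
  exact (mul_eq_zero.1 h0).resolve_right (sub_ne_zero.2 hlm)
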